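/- arXiv:1304.0283 — 4 statements merged into one kernel-verified Lean document; each statement's English description precedes it below -/
import Mathlib

section
/- For any real 3×3 matrix E and any real diagonal 3×3 matrices D₁ and D₂ all of whose diagonal entries lie in the interval [−1, 1], one has f(D₁ E D₂) ≤ f(E), where f(M) := ½(tr(MᵀM) − λ_max(MᵀM)). -/
open Matrix

noncomputable section

def lambdaMax (M : Matrix (Fin 3) (Fin 3) ℝ) : ℝ :=
  sSup {x : ℝ | ∃ v : Fin 3 → ℝ, v ≠ 0 ∧ M.mulVec v = x • v}

def f (M : Matrix (Fin 3) (Fin 3) ℝ) : ℝ :=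
  (1 / 2) * (Matrix.trace (Mᵀ * M) - lambdaMax (Mᵀ * M))

lemma dotProduct_transpose_mul_mulVec {m n : Type*} [Fintype m] [Fintype n]
    (M : Matrix m n ℝ) (x : n → ℝ) :
    x ⬝ᵥ ((Mᵀ * M) *ᵥ x) = (M *ᵥ x) ⬝ᵥ (M *ᵥ x) := by
  rw [← mulVec_mulVec, dotProduct_mulVec, vecMul_transpose]

lemma isCompact_setOf_dotProduct_self_eq_one {n : Type*} [Fintype n] :
    IsCompact {x : n → ℝ | x ⬝ᵥ x = 1} := by
  refine Metric.isCompact_of_isClosed_isBounded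
    (isClosed_eq (by unfold dotProduct; fun_prop) continuous_const) ?_
  refine (Metric.isBounded_closedBall (x := (0 : n → ℝ)) (r := 1)).subset fun x hx => ?_
  rw [mem_closedBall_zero_iff, pi_norm_le_iff_of_nonneg zero_le_one]
  intro i
  have hi : x i * x i ≤ x ⬝ᵥ x :=
    Finset.single_le_sum (f := fun j => x j * x j) (fun j _ => mul_self_nonneg _)
      (Finset.mem_univ i)
  rw [Set.mem_ofPred_eq] at hx
  rw [Real.norm_eq_abs, abs_le_one_iff_mul_self_le_one]
  linarith

/-- The Rayleigh quotient of `Mᵀ * M` attains its maximum at an eigenvector. -/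
lemma exists_eigenvector_forall_rayleigh_le {m n : Type*} [Fintype m] [Fintype n]
    [DecidableEq n] [Nonempty n] (M : Matrix m n ℝ) :
    ∃ (c : ℝ) (v : n → ℝ), v ⬝ᵥ v = 1 ∧ (Mᵀ * M) *ᵥ v = c • v ∧
      ∀ x, (M *ᵥ x) ⬝ᵥ (M *ᵥ x) ≤ c * (x ⬝ᵥ x) := by
  obtain ⟨v, hv, hmax⟩ := isCompact_setOf_dotProduct_self_eq_one.exists_isMaxOn
    (f := fun x : n → ℝ => (M *ᵥ x) ⬝ᵥ (M *ᵥ x))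
    ⟨Pi.single (Classical.arbitrary n) 1, by simp⟩
    (by unfold mulVec dotProduct; fun_prop)
  rw [Set.mem_ofPred_eq] at hv
  set c := (M *ᵥ v) ⬝ᵥ (M *ᵥ v) with hc
  have hle : ∀ x, (M *ᵥ x) ⬝ᵥ (M *ᵥ x) ≤ c * (x ⬝ᵥ x) := by
    intro x
    rcases eq_or_ne x 0 with rfl | hx
    · simp
    have hpos : 0 < x ⬝ᵥ x :=
      lt_of_le_of_ne (Finset.sum_nonneg fun i _ => mul_self_nonneg (x i))
        (Ne.symm (by simpa using hx))
    set r := (√(x ⬝ᵥ x))⁻¹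
    have hr : r * r * (x ⬝ᵥ x) = 1 := by
      rw [← mul_inv, Real.mul_self_sqrt hpos.le, inv_mul_cancel₀ hpos.ne']
    have h := hmax (show r • x ∈ {x : n → ℝ | x ⬝ᵥ x = 1} by
      simp only [Set.mem_ofPred_eq, smul_dotProduct, dotProduct_smul, smul_eq_mul]
      linarith)
    simp only [Set.mem_ofPred_eq, mulVec_smul, smul_dotProduct, dotProduct_smul,
      smul_eq_mul, ← hc] at h
    have h' := mul_le_mul_of_nonneg_right h hpos.le
    calc (M *ᵥ x) ⬝ᵥ (M *ᵥ x)
        = r * (r * ((M *ᵥ x) ⬝ᵥ (M *ᵥ x))) * (x ⬝ᵥ x) := by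
          linear_combination -((M *ᵥ x) ⬝ᵥ (M *ᵥ x)) * hr
      _ ≤ c * (x ⬝ᵥ x) := h'
  have hform : ∀ x, x ⬝ᵥ ((c • (1 : Matrix n n ℝ) - Mᵀ * M) *ᵥ x) =
      c * (x ⬝ᵥ x) - (M *ᵥ x) ⬝ᵥ (M *ᵥ x) := by
    intro x
    rw [sub_mulVec, dotProduct_sub, dotProduct_transpose_mul_mulVec, smul_mulVec,
      one_mulVec, dotProduct_smul, smul_eq_mul]
  have hpsd : (c • (1 : Matrix n n ℝ) - Mᵀ * M).PosSemidef := by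
    refine PosSemidef.of_dotProduct_mulVec_nonneg ?_ fun x => ?_
    · simp [IsHermitian, conjTranspose_eq_transpose_of_trivial]
    · rw [star_trivial, hform]
      exact sub_nonneg.2 (hle x)
  have hker := (hpsd.dotProduct_mulVec_zero_iff v).1 (by
    rw [star_trivial, hform, hv, mul_one, sub_self])
  rw [sub_mulVec, smul_mulVec, one_mulVec, sub_eq_zero] at hker
  exact ⟨c, v, hv, hker.symm, hle⟩

lemma exists_eigenvector_lambdaMax (M : Matrix (Fin 3) (Fin 3) ℝ) :
    ∃ v : Fin 3 → ℝ, v ⬝ᵥ v = 1 ∧ (Mᵀ * M) *ᵥ v = lambdaMax (Mᵀ * M) • v ∧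
      ∀ x, (M *ᵥ x) ⬝ᵥ (M *ᵥ x) ≤ lambdaMax (Mᵀ * M) * (x ⬝ᵥ x) := by
  obtain ⟨c, v, hv, hev, hle⟩ := exists_eigenvector_forall_rayleigh_le M
  have hc : lambdaMax (Mᵀ * M) = c := by
    refine IsGreatest.csSup_eq ⟨⟨v, ?_, hev⟩, ?_⟩
    · rintro rfl
      simp at hv
    · rintro y ⟨w, hw, hyw⟩
      have hpos : 0 < w ⬝ᵥ w :=
        lt_of_le_of_ne (Finset.sum_nonneg fun i _ => mul_self_nonneg (w i))
          (Ne.symm (by simpa using hw))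
      have h := hle w
      rw [← dotProduct_transpose_mul_mulVec, hyw, dotProduct_smul, smul_eq_mul] at h
      exact le_of_mul_le_mul_right h hpos
  exact ⟨v, hv, hc ▸ hev, hc ▸ hle⟩

lemma trace_transpose_mul_self_sub_vecMulVec (G : Matrix (Fin 3) (Fin 3) ℝ)
    (a b : Fin 3 → ℝ) :
    trace ((G - vecMulVec a b)ᵀ * (G - vecMulVec a b)) =
      trace (Gᵀ * G) - 2 * (a ⬝ᵥ (G *ᵥ b)) + (a ⬝ᵥ a) * (b ⬝ᵥ b) := by
  simp only [trace, diag_apply, mul_apply, transpose_apply, Matrix.sub_apply, vecMulVec_apply,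
    dotProduct, mulVec, Fin.sum_univ_three]
  ring

/-- Among rank-one perturbations of `G`, none has squared Frobenius norm below `2 * f G`. -/
lemma trace_sub_lambdaMax_le (G : Matrix (Fin 3) (Fin 3) ℝ) (a b : Fin 3 → ℝ) :
    trace (Gᵀ * G) - lambdaMax (Gᵀ * G) ≤
      trace ((G - vecMulVec a b)ᵀ * (G - vecMulVec a b)) := by
  obtain ⟨v, hv, -, hle⟩ := exists_eigenvector_lambdaMax G
  have hnonneg : ∀ x : Fin 3 → ℝ, 0 ≤ x ⬝ᵥ x := fun x =>
    Finset.sum_nonneg fun i _ => mul_self_nonneg (x i)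
  rw [trace_transpose_mul_self_sub_vecMulVec]
  rcases eq_or_ne b 0 with rfl | hb
  · have h := hle v
    have h' := hnonneg (G *ᵥ v)
    rw [hv] at h
    simp only [mulVec_zero, dotProduct_zero]
    linarith
  have hpos : 0 < b ⬝ᵥ b := lt_of_le_of_ne (hnonneg b) (Ne.symm (by simpa using hb))
  have h := hnonneg (G *ᵥ b - (b ⬝ᵥ b) • a)
  simp only [sub_dotProduct, dotProduct_sub, smul_dotProduct, dotProduct_smul,
    smul_eq_mul, dotProduct_comm (G *ᵥ b) a] at h
  have h' := hle b
  have hmul : 0 ≤ (b ⬝ᵥ b) *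
      (lambdaMax (Gᵀ * G) - 2 * (a ⬝ᵥ (G *ᵥ b)) + (a ⬝ᵥ a) * (b ⬝ᵥ b)) := by
    linarith
  linarith [nonneg_of_mul_nonneg_right hmul hpos]

lemma trace_transpose_mul_self_diagonal_mul_mul_diagonal_le {n : Type*} [Fintype n]
    [DecidableEq n] (N : Matrix n n ℝ) {d e : n → ℝ}
    (hd : ∀ i, d i ∈ Set.Icc (-1 : ℝ) 1) (he : ∀ i, e i ∈ Set.Icc (-1 : ℝ) 1) :
    trace ((diagonal d * N * diagonal e)ᵀ * (diagonal d * N * diagonal e)) ≤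
      trace (Nᵀ * N) := by
  simp only [trace, diag_apply, mul_apply (M := _ᵀ), transpose_apply, mul_diagonal,
    diagonal_mul]
  refine Finset.sum_le_sum fun i _ => Finset.sum_le_sum fun j _ => ?_
  rw [← abs_le_iff_mul_self_le, abs_mul, abs_mul]
  calc |d j| * |N j i| * |e i| ≤ 1 * |N j i| * 1 := by
        gcongr
        exacts [abs_le.2 (hd j), abs_le.2 (he i)]
    _ = |N j i| := by ring

/-- Contracting a real 3×3 matrix on both sides by diagonal matrices with entries in
[-1,1] does not increase f(M) = ½(tr(MᵀM) − λ_max(MᵀM)). -/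
theorem f_diag_contraction (E D₁ D₂ : Matrix (Fin 3) (Fin 3) ℝ)
    (hD₁ : ∃ d : Fin 3 → ℝ, D₁ = Matrix.diagonal d ∧ ∀ i, d i ∈ Set.Icc (-1 : ℝ) 1)
    (hD₂ : ∃ d : Fin 3 → ℝ, D₂ = Matrix.diagonal d ∧ ∀ i, d i ∈ Set.Icc (-1 : ℝ) 1) :
    f (D₁ * E * D₂) ≤ f E := by
  obtain ⟨d, rfl, hd⟩ := hD₁
  obtain ⟨e, rfl, he⟩ := hD₂
  obtain ⟨v, hv, hev, -⟩ := exists_eigenvector_lambdaMax E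
  have hEv : (E *ᵥ v) ⬝ᵥ (E *ᵥ v) = lambdaMax (Eᵀ * E) := by
    rw [← dotProduct_transpose_mul_mulVec, hev, dotProduct_smul, hv, smul_eq_mul, mul_one]
  have hlow := trace_sub_lambdaMax_le (diagonal d * E * diagonal e)
    (diagonal d *ᵥ (E *ᵥ v)) (v ᵥ* diagonal e)
  rw [← vecMulVec_mul, ← mul_vecMulVec, ← sub_mul, ← mul_sub] at hlow
  have hcontr := trace_transpose_mul_self_diagonal_mul_mul_diagonal_le
    (E - vecMulVec (E *ᵥ v) v) hd he
  have hbest := trace_transpose_mul_self_sub_vecMulVec E (E *ᵥ v) v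
  rw [hEv, hv] at hbest
  unfold f
  linarith

end
end

section
/- Let a ∈ ℝ³ and let M be a real symmetric 3×3 positive semidefinite matrix. Then λ_max(a aᵀ + M) ≤ |a|² + λ_max(M), with equality if and only if a = 0 or M a = λ_max(M) a (i.e., a is an eigenvector of M for its largest eigenvalue). Consequently, for a two-qubit state ρ, D_G(ρ) = F_RSP(ρ) whenever the local Bloch vector a(ρ) is zero or is an eigenvector of E Eᵀ corresponding to its largest eigenvalue. -/
open Matrix Kronecker ComplexOrder

noncomputable section

def pauli : Fin 3 → Matrix (Fin 2) (Fin 2) ℂ :=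
  ![!![0, 1; 1, 0], !![0, -Complex.I; Complex.I, 0], !![1, 0; 0, -1]]

def corr (ρ : Matrix (Fin 2 × Fin 2) (Fin 2 × Fin 2) ℂ) : Matrix (Fin 3) (Fin 3) ℝ :=
  Matrix.of fun k l => (Matrix.trace (ρ * (pauli k ⊗ₖ pauli l))).re

def Frsp (ρ : Matrix (Fin 2 × Fin 2) (Fin 2 × Fin 2) ℂ) : ℝ :=
  (1 / 2) * (Matrix.trace ((corr ρ)ᵀ * corr ρ) - lambdaMax ((corr ρ)ᵀ * corr ρ))

def damp (p : ℝ) : Fin 2 → Matrix (Fin 2) (Fin 2) ℂ :=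
  ![!![1, 0; 0, (Real.sqrt (1 - p) : ℂ)], !![0, (Real.sqrt p : ℂ); 0, 0]]

def Phi (p : ℝ) (ρ : Matrix (Fin 2 × Fin 2) (Fin 2 × Fin 2) ℂ) :
    Matrix (Fin 2 × Fin 2) (Fin 2 × Fin 2) ℂ :=
  ∑ i : Fin 2, ∑ j : Fin 2, (damp p i ⊗ₖ damp p j) * ρ * (damp p i ⊗ₖ damp p j)ᴴ

def bellDiag (c₁ c₂ c₃ : ℝ) : Matrix (Fin 2 × Fin 2) (Fin 2 × Fin 2) ℂ :=
  (1 / 4 : ℂ) • (1 + (c₁ : ℂ) • (pauli 0 ⊗ₖ pauli 0) + (c₂ : ℂ) • (pauli 1 ⊗ₖ pauli 1)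
    + (c₃ : ℂ) • (pauli 2 ⊗ₖ pauli 2))

def bloch (ρ : Matrix (Fin 2 × Fin 2) (Fin 2 × Fin 2) ℂ) : Fin 3 → ℝ :=
  fun k => (Matrix.trace (ρ * (pauli k ⊗ₖ (1 : Matrix (Fin 2) (Fin 2) ℂ)))).re

def Dg (ρ : Matrix (Fin 2 × Fin 2) (Fin 2 × Fin 2) ℂ) : ℝ :=
  (1 / 2) * ((∑ k, bloch ρ k ^ 2) + Matrix.trace (corr ρ * (corr ρ)ᵀ)
    - lambdaMax (Matrix.vecMulVec (bloch ρ) (bloch ρ) + corr ρ * (corr ρ)ᵀ))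


lemma exists_mulVec_eq_smul_iff (M : Matrix (Fin 3) (Fin 3) ℝ) (x : ℝ) :
    (∃ v : Fin 3 → ℝ, v ≠ 0 ∧ M *ᵥ v = x • v) ↔ M.charpoly.IsRoot x := by
  rw [Polynomial.IsRoot.def, eval_charpoly, ← exists_mulVec_eq_zero_iff]
  simp [sub_mulVec, sub_eq_zero, eq_comm]

lemma finite_setOf_mulVec_eq_smul (M : Matrix (Fin 3) (Fin 3) ℝ) :
    {x : ℝ | ∃ v : Fin 3 → ℝ, v ≠ 0 ∧ M *ᵥ v = x • v}.Finite := by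
  simp only [exists_mulVec_eq_smul_iff]
  exact Polynomial.finite_setOfPred_isRoot M.charpoly_monic.ne_zero

lemma lambdaMax_mul_comm (A B : Matrix (Fin 3) (Fin 3) ℝ) :
    lambdaMax (A * B) = lambdaMax (B * A) := by
  simp only [lambdaMax, exists_mulVec_eq_smul_iff, charpoly_mul_comm A B]

lemma le_lambdaMax {M : Matrix (Fin 3) (Fin 3) ℝ} {x : ℝ} {v : Fin 3 → ℝ} (hv : v ≠ 0)
    (h : M *ᵥ v = x • v) : x ≤ lambdaMax M :=
  le_csSup (finite_setOf_mulVec_eq_smul M).bddAbove ⟨v, hv, h⟩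

lemma Matrix.IsHermitian.eigenvectorBasis_ne_zero {M : Matrix (Fin 3) (Fin 3) ℝ}
    (hM : M.IsHermitian) (i : Fin 3) : ⇑(hM.eigenvectorBasis i) ≠ 0 := fun h =>
  hM.eigenvectorBasis.orthonormal.ne_zero i (PiLp.ext (congrFun h))

lemma Matrix.IsHermitian.exists_mulVec_eq_lambdaMax_smul {M : Matrix (Fin 3) (Fin 3) ℝ}
    (hM : M.IsHermitian) : ∃ v : Fin 3 → ℝ, v ≠ 0 ∧ M *ᵥ v = lambdaMax M • v :=
  Set.Nonempty.csSup_mem (s := {x : ℝ | ∃ v : Fin 3 → ℝ, v ≠ 0 ∧ M *ᵥ v = x • v})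
    ⟨_, _, hM.eigenvectorBasis_ne_zero 0, hM.mulVec_eigenvectorBasis 0⟩
    (finite_setOf_mulVec_eq_smul M)

lemma Matrix.IsHermitian.posSemidef_lambdaMax_smul_one_sub {M : Matrix (Fin 3) (Fin 3) ℝ}
    (hM : M.IsHermitian) : (lambdaMax M • 1 - M).PosSemidef := by
  have hN : (lambdaMax M • 1 - M).IsHermitian :=
    (isHermitian_one.smul (IsSelfAdjoint.all (lambdaMax M))).sub hM
  rw [hN.posSemidef_iff_eigenvalues_nonneg]
  intro i
  have h := hN.mulVec_eigenvectorBasis i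
  rw [sub_mulVec, smul_mulVec, one_mulVec, sub_eq_iff_eq_add', ← sub_eq_iff_eq_add,
    ← sub_smul] at h
  simpa using le_lambdaMax (hN.eigenvectorBasis_ne_zero i) h.symm

lemma dotProduct_sq_add_dotProduct_smul_sub_self (a u : Fin 3 → ℝ) :
    (a ⬝ᵥ u) ^ 2 * (u ⬝ᵥ u) +
      ((u ⬝ᵥ u) • a - (a ⬝ᵥ u) • u) ⬝ᵥ ((u ⬝ᵥ u) • a - (a ⬝ᵥ u) • u) =
      (a ⬝ᵥ a) * (u ⬝ᵥ u) * (u ⬝ᵥ u) := by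
  simp only [sub_dotProduct, dotProduct_sub, smul_dotProduct, dotProduct_smul, smul_eq_mul,
    dotProduct_comm u a]
  ring

lemma vecMulVec_add_mulVec (a u : Fin 3 → ℝ) (M : Matrix (Fin 3) (Fin 3) ℝ) :
    (vecMulVec a a + M) *ᵥ u = (a ⬝ᵥ u) • a + M *ᵥ u := by
  simp [add_mulVec, vecMulVec_mulVec]

/-- The gap `|a|² + λ_max(M) - λ_max(a aᵀ + M)`, scaled by `|u|⁴` for a top eigenvector `u` of
`a aᵀ + M`, is the sum of the Cauchy-Schwarz defect of `a, u` and the Rayleigh defect of `u`. -/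
lemma exists_lambdaMax_gap_eq (a : Fin 3 → ℝ) {M : Matrix (Fin 3) (Fin 3) ℝ}
    (hM : M.IsHermitian) : ∃ u : Fin 3 → ℝ, 0 < u ⬝ᵥ u ∧
      (a ⬝ᵥ a + lambdaMax M - lambdaMax (vecMulVec a a + M)) * (u ⬝ᵥ u) * (u ⬝ᵥ u) =
        ((u ⬝ᵥ u) • a - (a ⬝ᵥ u) • u) ⬝ᵥ ((u ⬝ᵥ u) • a - (a ⬝ᵥ u) • u) +
        (u ⬝ᵥ (lambdaMax M • 1 - M) *ᵥ u) * (u ⬝ᵥ u) := by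
  have hA : (vecMulVec a a + M).IsHermitian :=
    IsHermitian.add (by ext i j; simp [vecMulVec_apply, mul_comm]) hM
  obtain ⟨u, hu, h⟩ := hA.exists_mulVec_eq_lambdaMax_smul
  refine ⟨u, by simpa using dotProduct_star_self_pos_iff.2 hu, ?_⟩
  have h' := congrArg (u ⬝ᵥ ·) h
  simp only [vecMulVec_add_mulVec, dotProduct_add, dotProduct_smul, smul_eq_mul,
    dotProduct_comm u a] at h'
  rw [sub_mulVec, smul_mulVec, one_mulVec, dotProduct_sub u, dotProduct_smul (lambdaMax M),
    smul_eq_mul]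
  linear_combination (u ⬝ᵥ u) * h' - dotProduct_sq_add_dotProduct_smul_sub_self a u

lemma lambdaMax_vecMulVec_add_le (a : Fin 3 → ℝ) {M : Matrix (Fin 3) (Fin 3) ℝ}
    (hM : M.IsHermitian) : lambdaMax (vecMulVec a a + M) ≤ a ⬝ᵥ a + lambdaMax M := by
  obtain ⟨u, hu, h⟩ := exists_lambdaMax_gap_eq a hM
  have hP : 0 ≤ u ⬝ᵥ (lambdaMax M • 1 - M) *ᵥ u := by
    simpa using hM.posSemidef_lambdaMax_smul_one_sub.dotProduct_mulVec_nonneg u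
  have hC : 0 ≤ ((u ⬝ᵥ u) • a - (a ⬝ᵥ u) • u) ⬝ᵥ ((u ⬝ᵥ u) • a - (a ⬝ᵥ u) • u) := by
    simpa using dotProduct_star_self_nonneg ((u ⬝ᵥ u) • a - (a ⬝ᵥ u) • u)
  rw [← sub_nonneg]
  refine nonneg_of_mul_nonneg_left (nonneg_of_mul_nonneg_left ?_ hu) hu
  rw [h]
  positivity

lemma lambdaMax_vecMulVec_add_eq_iff (a : Fin 3 → ℝ) {M : Matrix (Fin 3) (Fin 3) ℝ}
    (hM : M.IsHermitian) : lambdaMax (vecMulVec a a + M) = a ⬝ᵥ a + lambdaMax M ↔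
      a = 0 ∨ M *ᵥ a = lambdaMax M • a := by
  refine ⟨fun heq => Or.inr ?_, ?_⟩
  · obtain ⟨u, hu, h⟩ := exists_lambdaMax_gap_eq a hM
    have hP : 0 ≤ u ⬝ᵥ (lambdaMax M • 1 - M) *ᵥ u := by
      simpa using hM.posSemidef_lambdaMax_smul_one_sub.dotProduct_mulVec_nonneg u
    have hC : 0 ≤ ((u ⬝ᵥ u) • a - (a ⬝ᵥ u) • u) ⬝ᵥ ((u ⬝ᵥ u) • a - (a ⬝ᵥ u) • u) := by
      simpa using dotProduct_star_self_nonneg ((u ⬝ᵥ u) • a - (a ⬝ᵥ u) • u)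
    rw [heq, sub_self, zero_mul, zero_mul, eq_comm,
      add_eq_zero_iff_of_nonneg hC (mul_nonneg hP hu.le), dotProduct_self_eq_zero, sub_eq_zero,
      mul_eq_zero, or_iff_left hu.ne'] at h
    obtain ⟨hau, hMu⟩ := h
    have hMu' : M *ᵥ u = lambdaMax M • u := by
      have := (hM.posSemidef_lambdaMax_smul_one_sub.dotProduct_mulVec_zero_iff u).1
        (by simpa using hMu)
      rw [sub_mulVec, smul_mulVec, one_mulVec, sub_eq_zero] at this
      exact this.symm
    refine smul_right_injective _ hu.ne' ?_
    simp only
    rw [← mulVec_smul, smul_comm, hau, mulVec_smul, hMu', smul_comm]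
  · rintro (rfl | ha)
    · simp
    · by_cases ha0 : a = 0
      · simp [ha0]
      refine (lambdaMax_vecMulVec_add_le a hM).antisymm (le_lambdaMax ha0 ?_)
      rw [vecMulVec_add_mulVec, ha, add_smul]

/-- For a ∈ ℝ³ and M real symmetric PSD 3×3, λ_max(aaᵀ + M) ≤ |a|² + λ_max(M), with
equality iff a = 0 or a is an eigenvector of M for λ_max(M); consequently D_G = F_RSP
for two-qubit states whose local Bloch vector is zero or is an eigenvector of EEᵀ for
its largest eigenvalue. -/
theorem lambdaMax_rankOne_add
    (a : Fin 3 → ℝ) (M : Matrix (Fin 3) (Fin 3) ℝ)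
    (hMsymm : M.IsSymm) (hMpsd : M.PosSemidef) :
    (lambdaMax (Matrix.vecMulVec a a + M) ≤ (∑ k, a k ^ 2) + lambdaMax M ∧
      (lambdaMax (Matrix.vecMulVec a a + M) = (∑ k, a k ^ 2) + lambdaMax M ↔
        a = 0 ∨ M.mulVec a = lambdaMax M • a)) ∧
    (∀ ρ : Matrix (Fin 2 × Fin 2) (Fin 2 × Fin 2) ℂ,
      ρ.PosSemidef → Matrix.trace ρ = 1 →
      (bloch ρ = 0 ∨
        (corr ρ * (corr ρ)ᵀ).mulVec (bloch ρ)
          = lambdaMax (corr ρ * (corr ρ)ᵀ) • bloch ρ) →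
      Dg ρ = Frsp ρ) := by
  have hsq : ∀ b : Fin 3 → ℝ, ∑ k, b k ^ 2 = b ⬝ᵥ b := fun b => by simp [dotProduct, sq]
  simp only [hsq]
  refine ⟨⟨lambdaMax_vecMulVec_add_le a hMpsd.isHermitian,
    lambdaMax_vecMulVec_add_eq_iff a hMpsd.isHermitian⟩, fun ρ _ _ h => ?_⟩
  have hE : (corr ρ * (corr ρ)ᵀ).IsHermitian := by
    simpa using isHermitian_mul_conjTranspose_self (corr ρ)
  rw [Dg, Frsp, hsq, (lambdaMax_vecMulVec_add_eq_iff _ hE).2 h, trace_mul_comm (corr ρ)ᵀ,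
    lambdaMax_mul_comm (corr ρ)ᵀ]
  ring


end
end

section
/- For any real numbers c₁, c₂, c₃, the RSP-fidelity of the Bell-diagonal state ρ(c₁,c₂,c₃) equals F_RSP(ρ(c₁,c₂,c₃)) = ½(c₁² + c₂² + c₃² − max{c₁², c₂², c₃²}). -/
open Matrix Kronecker ComplexOrder

noncomputable section

theorem trace_pauli (i : Fin 3) : (pauli i).trace = 0 := by
  fin_cases i <;> simp [pauli, Matrix.trace_fin_two]

theorem trace_pauli_mul_pauli (i j : Fin 3) :
    (pauli i * pauli j).trace = if i = j then 2 else 0 := by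
  fin_cases i <;> fin_cases j <;>
    simp [pauli, Matrix.trace_fin_two, one_add_one_eq_two]

theorem trace_kronecker_pauli_mul (i k l : Fin 3) :
    ((pauli i ⊗ₖ pauli i) * (pauli k ⊗ₖ pauli l)).trace =
      (if i = k then 2 else 0) * (if i = l then 2 else 0) := by
  rw [← Matrix.mul_kronecker_mul, Matrix.trace_kronecker, trace_pauli_mul_pauli,
    trace_pauli_mul_pauli]

theorem corr_bellDiag (c₁ c₂ c₃ : ℝ) :
    corr (bellDiag c₁ c₂ c₃) = Matrix.diagonal ![c₁, c₂, c₃] := by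
  ext k l
  simp only [corr, bellDiag, Matrix.of_apply, smul_mul, Matrix.add_mul, Matrix.trace_smul,
    Matrix.trace_add, Matrix.one_mul, trace_kronecker_pauli_mul, Matrix.trace_kronecker,
    trace_pauli]
  fin_cases k <;> fin_cases l <;> simp [Fin.ext_iff] <;> ring

/-- The largest eigenvalue of a diagonal matrix is its largest diagonal entry. -/
theorem lambdaMax_diagonal (d : Fin 3 → ℝ) : lambdaMax (Matrix.diagonal d) = ⨆ i, d i := by
  unfold lambdaMax iSup
  congr 1
  ext x
  constructor
  · rintro ⟨v, hv, h⟩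
    obtain ⟨i, hi⟩ := Function.ne_iff.mp hv
    refine ⟨i, mul_right_cancel₀ hi ?_⟩
    simpa [Matrix.mulVec_diagonal] using congrFun h i
  · rintro ⟨i, rfl⟩
    exact ⟨Pi.single i 1, by simp, by simp [← Pi.single_smul]⟩

theorem ciSup_fin_three (d : Fin 3 → ℝ) : ⨆ i, d i = max (max (d 0) (d 1)) (d 2) := by
  apply le_antisymm
  · apply ciSup_le
    intro i
    fin_cases i <;> simp
  · have h := le_ciSup (Set.finite_range d).bddAbove
    exact max_le (max_le (h 0) (h 1)) (h 2)

/-- RSP-fidelity of a Bell-diagonal state. -/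
theorem frsp_bellDiag (c₁ c₂ c₃ : ℝ) :
    Frsp (bellDiag c₁ c₂ c₃) =
      (1 / 2) * (c₁ ^ 2 + c₂ ^ 2 + c₃ ^ 2 - max (max (c₁ ^ 2) (c₂ ^ 2)) (c₃ ^ 2)) := by
  simp only [Frsp, corr_bellDiag, Matrix.diagonal_transpose, Matrix.diagonal_mul_diagonal,
    lambdaMax_diagonal, ciSup_fin_three, Matrix.trace_diagonal, Fin.sum_univ_three]
  simp [sq]

end
end

section
/- Let ρ₀ := ρ(1/2, 0, −1/2) (which is a positive semidefinite density matrix). Then: (i) F_RSP(ρ₀) = 1/8 > 0; (ii) F_RSP(Φ_p(ρ₀)) = 0 for p = √2 − 1; and (iii) F_RSP(Φ_p(ρ₀)) > 0 for every p ∈ (0,1) with p ≠ √2 − 1. In particular, under local amplitude damping decoherence the RSP-fidelity vanishes at an isolated instant and then revives. -/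
open Matrix Kronecker ComplexOrder

noncomputable section

theorem pauli_trace_mul (k l : Fin 3) :
    Matrix.trace (pauli k * pauli l) = if k = l then 2 else 0 := by
  fin_cases k <;> fin_cases l <;> simp [pauli, Matrix.trace_fin_two] <;> norm_num

theorem pauli_trace (k : Fin 3) : Matrix.trace (pauli k) = 0 := by
  fin_cases k <;> simp [pauli, Matrix.trace_fin_two]

/-- The single-qubit amplitude damping channel. -/
def ampDamp (p : ℝ) (A : Matrix (Fin 2) (Fin 2) ℂ) : Matrix (Fin 2) (Fin 2) ℂ :=
  ∑ i, damp p i * A * (damp p i)ᴴ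

theorem Phi_kronecker (p : ℝ) (A B : Matrix (Fin 2) (Fin 2) ℂ) :
    Phi p (A ⊗ₖ B) = ampDamp p A ⊗ₖ ampDamp p B := by
  simp only [Phi, ampDamp, Matrix.conjTranspose_kronecker, ← Matrix.mul_kronecker_mul,
    Fin.sum_univ_two, Matrix.add_kronecker, Matrix.kronecker_add]
  abel

theorem Phi_add (p : ℝ) (ρ σ : Matrix (Fin 2 × Fin 2) (Fin 2 × Fin 2) ℂ) :
    Phi p (ρ + σ) = Phi p ρ + Phi p σ := by
  simp only [Phi, Matrix.mul_add, Matrix.add_mul, Finset.sum_add_distrib]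

theorem Phi_smul (p : ℝ) (c : ℂ) (ρ : Matrix (Fin 2 × Fin 2) (Fin 2 × Fin 2) ℂ) :
    Phi p (c • ρ) = c • Phi p ρ := by
  simp only [Phi, Matrix.mul_smul, Matrix.smul_mul, Finset.smul_sum]

theorem ofReal_sqrt_mul_self {x : ℝ} (hx : 0 ≤ x) : (Real.sqrt x : ℂ) * Real.sqrt x = x := by
  rw [← Complex.ofReal_mul, Real.mul_self_sqrt hx]

section ampDamp

variable {p : ℝ}

theorem ampDamp_of (h₀ : 0 ≤ p) (h₁ : p ≤ 1) (a b c d : ℂ) :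
    ampDamp p !![a, b; c, d] =
      !![a + p * d, Real.sqrt (1 - p) * b; Real.sqrt (1 - p) * c, (1 - p) * d] := by
  have hp := ofReal_sqrt_mul_self h₀
  have hq := ofReal_sqrt_mul_self (sub_nonneg.2 h₁)
  push_cast at hq
  ext i j
  fin_cases i <;> fin_cases j <;>
    simp [ampDamp, damp, Matrix.mul_apply, Fin.sum_univ_two, -Matrix.cons_mul] <;> grind

theorem ampDamp_one (h₀ : 0 ≤ p) (h₁ : p ≤ 1) : ampDamp p 1 = 1 + (p : ℂ) • pauli 2 := by
  rw [Matrix.one_fin_two, ampDamp_of h₀ h₁]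
  simp [pauli, sub_eq_add_neg]

theorem ampDamp_pauli_zero (h₀ : 0 ≤ p) (h₁ : p ≤ 1) :
    ampDamp p (pauli 0) = (Real.sqrt (1 - p) : ℂ) • pauli 0 := by
  simp [pauli, ampDamp_of h₀ h₁]

theorem ampDamp_pauli_one (h₀ : 0 ≤ p) (h₁ : p ≤ 1) :
    ampDamp p (pauli 1) = (Real.sqrt (1 - p) : ℂ) • pauli 1 := by
  simp [pauli, ampDamp_of h₀ h₁]

theorem ampDamp_pauli_two (h₀ : 0 ≤ p) (h₁ : p ≤ 1) :
    ampDamp p (pauli 2) = ((1 - p : ℝ) : ℂ) • pauli 2 := by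
  simp [pauli, ampDamp_of h₀ h₁, sub_eq_add_neg]

theorem corr_Phi_bellDiag (h₀ : 0 ≤ p) (h₁ : p ≤ 1) (c₁ c₂ c₃ : ℝ) :
    corr (Phi p (bellDiag c₁ c₂ c₃)) =
      Matrix.diagonal ![(1 - p) * c₁, (1 - p) * c₂, (1 - p) ^ 2 * c₃ + p ^ 2] := by
  have hq := Real.mul_self_sqrt (sub_nonneg.2 h₁)
  ext k l
  simp only [corr, bellDiag, Matrix.of_apply, Phi_smul, Phi_add, Phi_kronecker,
    ← Matrix.one_kronecker_one (α := ℂ) (m := Fin 2) (n := Fin 2), ampDamp_one h₀ h₁,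
    ampDamp_pauli_zero h₀ h₁, ampDamp_pauli_one h₀ h₁, ampDamp_pauli_two h₀ h₁,
    Matrix.smul_mul, Matrix.add_mul, Matrix.one_mul,
    ← Matrix.mul_kronecker_mul, Matrix.trace_add, Matrix.trace_smul, Matrix.trace_kronecker,
    pauli_trace_mul, pauli_trace]
  fin_cases k <;> fin_cases l <;> simp <;> grind

end ampDamp

theorem Frsp_eq_min {ρ : Matrix (Fin 2 × Fin 2) (Fin 2 × Fin 2) ℂ} {a b : ℝ}
    (h : corr ρ = Matrix.diagonal ![a, 0, b]) : Frsp ρ = min (a ^ 2) (b ^ 2) / 2 := by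
  have hsup : ⨆ i, (![a, 0, b] i) * (![a, 0, b] i) = max (a ^ 2) (b ^ 2) := by
    apply le_antisymm
    · refine ciSup_le fun i => ?_
      fin_cases i
      · simp [← sq]
      · simp [sq_nonneg]
      · simp [← sq]
    · have hb := Set.finite_range fun i => (![a, 0, b] i) * (![a, 0, b] i)
      refine max_le ?_ ?_
      · simpa [← sq] using le_ciSup hb.bddAbove 0
      · simpa [← sq] using le_ciSup hb.bddAbove 2
  rw [Frsp, h, Matrix.diagonal_transpose, Matrix.diagonal_mul_diagonal, lambdaMax_diagonal, hsup,
    Matrix.trace_diagonal]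
  simp only [Fin.sum_univ_three]
  have := min_add_max (a ^ 2) (b ^ 2)
  simp
  linarith

theorem Frsp_Phi {p : ℝ} (h₀ : 0 ≤ p) (h₁ : p ≤ 1) :
    Frsp (Phi p (bellDiag (1 / 2) 0 (-1 / 2))) =
      min (((1 - p) / 2) ^ 2) ((((p + 1) ^ 2 - 2) / 2) ^ 2) / 2 := by
  apply Frsp_eq_min
  rw [corr_Phi_bellDiag h₀ h₁]
  congr 2
  · ring
  · congr 1
    · ring
    · congr 1; ring

/-- For the Bell-diagonal state ρ(1/2, 0, −1/2), the RSP-fidelity starts at 1/8,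
vanishes exactly at the damping parameter p = √2 − 1, and is strictly positive at
every other p ∈ (0,1): it vanishes at an isolated instant and then revives. -/
theorem frsp_vanishes_at_instant :
    Frsp (bellDiag (1 / 2) 0 (-1 / 2)) = 1 / 8 ∧
    (0 : ℝ) < 1 / 8 ∧
    Frsp (Phi (Real.sqrt 2 - 1) (bellDiag (1 / 2) 0 (-1 / 2))) = 0 ∧
    ∀ p ∈ Set.Ioo (0 : ℝ) 1, p ≠ Real.sqrt 2 - 1 →
      0 < Frsp (Phi p (bellDiag (1 / 2) 0 (-1 / 2))) := by
  have h2 : Real.sqrt 2 ^ 2 = 2 := Real.sq_sqrt zero_le_two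
  refine ⟨?_, by norm_num, ?_, ?_⟩
  · rw [Frsp_eq_min (corr_bellDiag _ _ _)]
    norm_num
  · have h₀ : 1 ≤ Real.sqrt 2 := Real.one_le_sqrt.2 one_le_two
    rw [Frsp_Phi (by linarith) (by nlinarith)]
    simp [h2, sq_nonneg]
  · rintro p ⟨h₀, h₁⟩ hne
    rw [Frsp_Phi h₀.le h₁.le]
    have hb : (p + 1) ^ 2 - 2 ≠ 0 := fun h => hne <| by
      rw [← sub_eq_zero.1 h, Real.sqrt_sq (by linarith)]
      ring
    have ha : 1 - p ≠ 0 := by linarith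
    refine half_pos (lt_min ?_ ?_) <;> positivity

end
end
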